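/- arXiv:0908.3623 — 2 statements merged into one kernel-verified Lean document; each statement's English description precedes it below -/
import Mathlib

section
/- Let 0 < α < ∞ and let U and V be unitary operators on a separable Hilbert space such that rank(U − V) < ∞. Then for every function f in the Hölder–Zygmund class Λ_α on the unit circle, f(U) − f(V) belongs to the weak Schatten class S_{1/α,∞}. -/
open scoped BigOperators
noncomputable section

/-- The `j`-th singular value of a bounded operator `T` on a Hilbert space:
`s_j(T) = inf {‖T - R‖ : rank R ≤ j}`. -/
def sVal {H : Type} [NormedAddCommGroup H] [InnerProductSpace ℂ H] [CompleteSpace H]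
    (T : H →L[ℂ] H) (j : ℕ) : ℝ :=
  sInf {c : ℝ | ∃ R : H →L[ℂ] H, LinearMap.rank (R : H →ₗ[ℂ] H) ≤ (j : Cardinal) ∧ c = ‖T - R‖}

/-- Membership in the weak Schatten class `S_{p,∞}`:  `sup_j (1+j) s_j(T)^p < ∞`. -/
def MemWeakSchatten {H : Type} [NormedAddCommGroup H] [InnerProductSpace ℂ H] [CompleteSpace H]
    (p : ℝ) (T : H →L[ℂ] H) : Prop :=
  ∃ C : ℝ, ∀ j : ℕ, (1 + (j : ℝ)) * sVal T j ^ p ≤ C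

/-- The weak Schatten quasinorm `‖T‖_{S_{p,∞}} = (sup_{j ≥ 0} (1+j) s_j(T)^p)^{1/p}`. -/
def wkNorm {H : Type} [NormedAddCommGroup H] [InnerProductSpace ℂ H] [CompleteSpace H]
    (p : ℝ) (T : H →L[ℂ] H) : ℝ :=
  (⨆ j : ℕ, (1 + (j : ℝ)) * sVal T j ^ p) ^ (1 / p)

/-- The difference operator on the circle: `(Δ_τ f)(ζ) = f(τζ) - f(ζ)`. -/
def cdiff (τ : ℂ) (f : ℂ → ℂ) : ℂ → ℂ := fun ζ => f (τ * ζ) - f ζ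

/-- `f` satisfies the Hölder–Zygmund condition of order `α` on the circle (via `m`-th differences)
with constant `C`: `|(Δ_τ^m f)(ζ)| ≤ C |1 - τ|^α` for `ζ, τ` on the circle. -/
def HZCircleWith (m : ℕ) (C α : ℝ) (f : ℂ → ℂ) : Prop :=
  ∀ ζ τ : ℂ, ‖ζ‖ = 1 → ‖τ‖ = 1 → ‖(cdiff τ)^[m] f ζ‖ ≤ C * ‖1 - τ‖ ^ α

/-- Membership in the Hölder–Zygmund class `Λ_α` on the unit circle: continuous functions on the
circle satisfying the Hölder–Zygmund condition of order `α` via `m`-th differences, where `m` is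
the least integer greater than `α`. -/
def MemHZCircle (α : ℝ) (f : ℂ → ℂ) : Prop :=
  ContinuousOn f (Metric.sphere (0 : ℂ) 1) ∧
    ∃ C : ℝ, 0 ≤ C ∧ HZCircleWith (Nat.floor α + 1) C α f

/-- Trigonometric polynomials of degree at most `N`, as functions of the complex variable. -/
def trigPoly (N : ℕ) : Submodule ℂ (ℂ → ℂ) :=
  Submodule.span ℂ ((fun (j : ℤ) (z : ℂ) => z ^ j) '' {j | j.natAbs ≤ N})

lemma zpow_mem_trigPoly {N : ℕ} {j : ℤ} (hj : j.natAbs ≤ N) :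
    (fun z : ℂ => z ^ j) ∈ trigPoly N :=
  Submodule.subset_span ⟨j, hj, rfl⟩

lemma continuousOn_of_mem_trigPoly {N : ℕ} {p : ℂ → ℂ} (hp : p ∈ trigPoly N) :
    ContinuousOn p (Metric.sphere (0 : ℂ) 1) := by
  induction hp using Submodule.span_induction with
  | mem p hp =>
    obtain ⟨j, -, rfl⟩ := hp
    refine continuousOn_id.zpow₀ j fun z hz => Or.inl ?_
    rintro rfl
    simp at hz
  | zero => exact continuousOn_const
  | add p q _ _ hp hq => exact hp.add hq
  | smul c p _ hp => exact continuousOn_const.smul hp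

section Rank

variable {H : Type} [NormedAddCommGroup H] [InnerProductSpace ℂ H]

/-- A subspace containing the ranges of `u ^ j - v ^ j` for `|j| ≤ N`. -/
def zpowDiffRange (u v : (H →L[ℂ] H)ˣ) (N : ℕ) : Submodule ℂ H :=
  ⨆ i ∈ Finset.Ico (-(N : ℤ)) N,
    (LinearMap.range ((u - v : H →L[ℂ] H) : H →ₗ[ℂ] H)).map
      (((u ^ i : (H →L[ℂ] H)ˣ) : H →L[ℂ] H) : H →ₗ[ℂ] H)

lemma zpow_sub_zpow_apply_mem (u v : (H →L[ℂ] H)ˣ) {N : ℕ} {j : ℤ} (hj : j.natAbs ≤ N) :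
    ∀ x, (((u ^ j : (H →L[ℂ] H)ˣ) : H →L[ℂ] H) - ((v ^ j : (H →L[ℂ] H)ˣ) : H →L[ℂ] H)) x
      ∈ zpowDiffRange u v N := by
  have step : ∀ (j : ℤ) (x : H),
      (((u ^ (j + 1) : (H →L[ℂ] H)ˣ) : H →L[ℂ] H) -
          ((v ^ (j + 1) : (H →L[ℂ] H)ˣ) : H →L[ℂ] H)) x =
        ((u ^ j : (H →L[ℂ] H)ˣ) : H →L[ℂ] H) ((u - v : H →L[ℂ] H) x) +
        (((u ^ j : (H →L[ℂ] H)ˣ) : H →L[ℂ] H) - ((v ^ j : (H →L[ℂ] H)ˣ) : H →L[ℂ] H))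
          ((v : H →L[ℂ] H) x) := by
    intro j x
    simp [zpow_add]
  have mem : ∀ (j : ℤ) (x : H), -(N : ℤ) ≤ j → j < N →
      ((u ^ j : (H →L[ℂ] H)ˣ) : H →L[ℂ] H) ((u - v : H →L[ℂ] H) x) ∈ zpowDiffRange u v N := by
    intro j x h1 h2
    refine Submodule.mem_iSup_of_mem j
      (Submodule.mem_iSup_of_mem (Finset.mem_Ico.2 ⟨h1, h2⟩) ?_)
    exact Submodule.mem_map_of_mem (LinearMap.mem_range_self _ x)
  induction j using Int.induction_on with
  | zero => simp
  | succ k ih =>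
    intro x
    rw [step]
    exact add_mem (mem _ _ (by lia) (by lia)) (ih (by lia) _)
  | pred k ih =>
    intro x
    have h := step (-(k : ℤ) - 1) (((v⁻¹ : (H →L[ℂ] H)ˣ) : H →L[ℂ] H) x)
    rw [sub_add_cancel, ← mul_apply_eq_comp (v : H →L[ℂ] H), Units.mul_inv,
      one_apply_eq_self] at h
    rw [← sub_eq_iff_eq_add'.2 h]
    exact sub_mem (ih (by lia) _) (mem _ _ (by lia) (by lia))

lemma rank_biSup_le {ι : Type} (s : Finset ι) (W : ι → Submodule ℂ H) (r : Cardinal)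
    (hW : ∀ i, Module.rank ℂ (W i) ≤ r) :
    Module.rank ℂ (⨆ i ∈ s, W i : Submodule ℂ H) ≤ s.card * r := by
  classical
  induction s using Finset.induction_on with
  | empty => simp
  | insert a s ha ih =>
    rw [Finset.iSup_insert, Finset.card_insert_of_notMem ha]
    refine (Submodule.rank_add_le_rank_add_rank _ _).trans ?_
    push_cast
    rw [add_mul, one_mul, add_comm]
    exact add_le_add ih (hW a)

lemma rank_zpowDiffRange_le (u v : (H →L[ℂ] H)ˣ) (N : ℕ) :
    Module.rank ℂ (zpowDiffRange u v N) ≤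
      (2 * N : ℕ) * LinearMap.rank ((u - v : H →L[ℂ] H) : H →ₗ[ℂ] H) := by
  refine (rank_biSup_le _ _ _ fun i => rank_map_le _ _).trans_eq ?_
  rw [Int.card_Ico, show ((N : ℤ) - -N).toNat = 2 * N by lia]

variable [CompleteSpace H]

lemma rank_cfc_sub_cfc_le {U V : H →L[ℂ] H} (hU : U ∈ unitary (H →L[ℂ] H))
    (hV : V ∈ unitary (H →L[ℂ] H)) {N : ℕ} {p : ℂ → ℂ} (hp : p ∈ trigPoly N) :
    LinearMap.rank ((cfc p U - cfc p V : H →L[ℂ] H) : H →ₗ[ℂ] H) ≤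
      (2 * N : ℕ) * LinearMap.rank ((U - V : H →L[ℂ] H) : H →ₗ[ℂ] H) := by
  have nU : IsStarNormal U := ((Unitary.mem_iff.1 hU).1.trans (Unitary.mem_iff.1 hU).2.symm) |> .mk
  have nV : IsStarNormal V := ((Unitary.mem_iff.1 hV).1.trans (Unitary.mem_iff.1 hV).2.symm) |> .mk
  let u : (H →L[ℂ] H)ˣ := Unitary.toUnits ⟨U, hU⟩
  let v : (H →L[ℂ] H)ˣ := Unitary.toUnits ⟨V, hV⟩
  have key : ∀ x, (cfc p U - cfc p V) x ∈ zpowDiffRange u v N := by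
    induction hp using Submodule.span_induction with
    | mem p hp =>
      obtain ⟨j, hj, rfl⟩ := hp
      have hu : cfc (fun z : ℂ => z ^ j) U = ((u ^ j : (H →L[ℂ] H)ˣ) : H →L[ℂ] H) :=
        cfc_zpow u j nU
      have hv : cfc (fun z : ℂ => z ^ j) V = ((v ^ j : (H →L[ℂ] H)ˣ) : H →L[ℂ] H) :=
        cfc_zpow v j nV
      rw [hu, hv]
      exact zpow_sub_zpow_apply_mem u v hj
    | zero =>
      intro x
      have h0 : (0 : ℂ → ℂ) = fun _ => 0 := rfl
      simp [h0]
    | add p q hp hq ihp ihq =>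
      intro x
      have cp := continuousOn_of_mem_trigPoly hp
      have cq := continuousOn_of_mem_trigPoly hq
      have e : ∀ T ∈ unitary (H →L[ℂ] H), cfc (p + q) T = cfc p T + cfc q T := fun T hT =>
        cfc_add T p q (cp.mono (spectrum.subset_circle_of_unitary hT))
          (cq.mono (spectrum.subset_circle_of_unitary hT))
      rw [e U hU, e V hV, add_sub_add_comm]
      exact add_mem (ihp x) (ihq x)
    | smul c p hp ihp =>
      intro x
      have cp := continuousOn_of_mem_trigPoly hp
      have e : ∀ T ∈ unitary (H →L[ℂ] H), cfc (c • p) T = c • cfc p T := fun T hT =>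
        cfc_smul c p T (cp.mono (spectrum.subset_circle_of_unitary hT))
      rw [e U hU, e V hV, ← smul_sub]
      exact Submodule.smul_mem _ c (ihp x)
  refine le_trans (Submodule.rank_mono ?_) (rank_zpowDiffRange_le u v N)
  rintro _ ⟨x, rfl⟩
  exact key x

end Rank

section CircleMean

open MeasureTheory

/-- The unit circle in the complex plane. -/
abbrev UnitCircle : Type := Metric.sphere (0 : ℂ) 1

/-- The normalized Haar measure on the circle. -/
def circleHaar : Measure UnitCircle := Measure.haarMeasure ⊤

instance : circleHaar.IsHaarMeasure := by
  unfold circleHaar; infer_instance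

instance : IsProbabilityMeasure circleHaar :=
  ⟨by simpa [circleHaar] using Measure.haarMeasure_self (G := UnitCircle) (K₀ := ⊤)⟩

lemma integrable_circleHaar {E : Type} [NormedAddCommGroup E] {g : UnitCircle → E}
    (hg : Continuous g) : Integrable g circleHaar :=
  hg.integrable_of_hasCompactSupport (HasCompactSupport.of_compactSpace g)

namespace UnitCircle

lemma norm_coe (τ : UnitCircle) : ‖(τ : ℂ)‖ = 1 := norm_eq_of_mem_sphere τ

lemma coe_ne_zero (τ : UnitCircle) : (τ : ℂ) ≠ 0 := ne_zero_of_mem_unit_sphere τ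

lemma continuous_coe_zpow (j : ℤ) : Continuous fun τ : UnitCircle => (τ : ℂ) ^ j :=
  continuous_subtype_val.zpow₀ j fun τ => Or.inl (coe_ne_zero τ)

lemma exists_coe_eq {w : ℂ} {k : ℕ} (hk : k ≠ 0) (hw : ‖w ^ k‖ = 1) :
    ∃ σ : UnitCircle, (σ : ℂ) = w := by
  rw [norm_pow, pow_eq_one_iff_of_nonneg (norm_nonneg _) hk] at hw
  exact ⟨⟨w, by simpa using hw⟩, rfl⟩

lemma exists_pow_eq {k : ℕ} (hk : k ≠ 0) (z : UnitCircle) : ∃ σ : UnitCircle, σ ^ k = z := by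
  obtain ⟨w, hw⟩ := IsAlgClosed.exists_pow_nat_eq (z : ℂ) (Nat.pos_of_ne_zero hk)
  obtain ⟨σ, rfl⟩ := exists_coe_eq hk (hw ▸ norm_coe z)
  exact ⟨σ, Subtype.ext hw⟩

lemma exists_pow_eq_one_zpow_ne_one {k : ℕ} (hk : k ≠ 0) {j : ℤ} (hj : ¬ (k : ℤ) ∣ j) :
    ∃ σ : UnitCircle, σ ^ k = 1 ∧ (σ : ℂ) ^ j ≠ 1 := by
  have h := Complex.isPrimitiveRoot_exp k hk
  obtain ⟨σ, hσ⟩ := exists_coe_eq hk (by rw [h.pow_eq_one, norm_one])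
  rw [← hσ] at h
  exact ⟨σ, Subtype.ext h.pow_eq_one, fun h1 => hj ((h.zpow_eq_one_iff_dvd j).1 h1)⟩

end UnitCircle

open UnitCircle

/-- If `K` is a trigonometric polynomial, so is `z ↦ ∫ K τ * f (τ ^ k * z) dτ`. -/
lemma exists_trigPoly_eq_integral {f : ℂ → ℂ} (hf : ContinuousOn f (Metric.sphere (0 : ℂ) 1))
    {k : ℕ} (hk : k ≠ 0) {N : ℕ} {K : ℂ → ℂ} (hK : K ∈ trigPoly N) :
    ∃ p ∈ trigPoly N, ∀ z : UnitCircle,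
      p z = ∫ τ : UnitCircle, K τ * f ((τ : ℂ) ^ k * z) ∂circleHaar := by
  have hc : ∀ z : UnitCircle, Continuous fun τ : UnitCircle => f ((τ : ℂ) ^ k * z) := fun z =>
    hf.comp_continuous (by fun_prop) (by simp)
  have hKc : ∀ {K : ℂ → ℂ}, K ∈ trigPoly N → Continuous fun τ : UnitCircle => K τ := fun hK =>
    (continuousOn_of_mem_trigPoly hK).comp_continuous continuous_subtype_val (by simp)
  induction hK using Submodule.span_induction with
  | mem K hK =>
    obtain ⟨j, hj, rfl⟩ := hK
    let g : UnitCircle → ℂ := fun z => ∫ τ : UnitCircle, (τ : ℂ) ^ j * f ((τ : ℂ) ^ k * z) ∂circleHaar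
    have hg : ∀ σ z : UnitCircle, (σ : ℂ) ^ j * g (σ ^ k * z) = g z := by
      intro σ z
      simp only [g]
      rw [← integral_const_mul,
        ← integral_mul_left_eq_self (fun τ : UnitCircle => (τ : ℂ) ^ j * f ((τ : ℂ) ^ k * z)) σ]
      congr 1 with τ
      simp only [Metric.unitSphere.coe_mul, Metric.unitSphere.coe_pow, mul_zpow, mul_pow]
      ring_nf
    by_cases hkj : (k : ℤ) ∣ j
    · obtain ⟨l, rfl⟩ := hkj
      refine ⟨g 1 • fun z => z ^ (-l), Submodule.smul_mem _ _ (zpow_mem_trigPoly ?_), ?_⟩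
      · rw [Int.natAbs_neg]
        refine le_trans ?_ hj
        rw [Int.natAbs_mul, Int.natAbs_natCast]
        exact Nat.le_mul_of_pos_left _ (Nat.pos_of_ne_zero hk)
      · intro z
        obtain ⟨σ, rfl⟩ := exists_pow_eq hk z
        have h := hg σ 1
        rw [mul_one, zpow_mul, zpow_natCast] at h
        have h0 : ((σ : ℂ) ^ k) ^ l ≠ 0 := zpow_ne_zero _ (pow_ne_zero _ (coe_ne_zero σ))
        change g 1 * ((σ ^ k : UnitCircle) : ℂ) ^ (-l) = g (σ ^ k)
        rw [← h, Metric.unitSphere.coe_pow, zpow_neg]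
        field_simp
    · refine ⟨0, Submodule.zero_mem _, fun z => ?_⟩
      obtain ⟨σ, hσ, hσj⟩ := exists_pow_eq_one_zpow_ne_one hk hkj
      have h := hg σ z
      rw [hσ, one_mul] at h
      have h' : ((σ : ℂ) ^ j - 1) * g z = 0 := by rw [sub_mul, h, one_mul, sub_self]
      rcases mul_eq_zero.1 h' with h1 | h1
      · exact absurd (sub_eq_zero.1 h1) hσj
      · exact h1.symm
  | zero => exact ⟨0, Submodule.zero_mem _, by simp⟩
  | add K L hK hL ihK ihL =>
    obtain ⟨p, hp, hp'⟩ := ihK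
    obtain ⟨q, hq, hq'⟩ := ihL
    refine ⟨p + q, Submodule.add_mem _ hp hq, fun z => ?_⟩
    simp only [Pi.add_apply, add_mul]
    rw [integral_add (integrable_circleHaar ((hKc hK).fun_mul (hc z)))
      (integrable_circleHaar ((hKc hL).fun_mul (hc z))), hp', hq']
  | smul c K hK ihK =>
    obtain ⟨p, hp, hp'⟩ := ihK
    refine ⟨c • p, Submodule.smul_mem _ c hp, fun z => ?_⟩
    simp only [Pi.smul_apply, smul_eq_mul, mul_assoc]
    rw [integral_const_mul, hp']

lemma integral_circle_zpow (j : ℤ) :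
    ∫ τ : UnitCircle, (τ : ℂ) ^ j ∂circleHaar = if j = 0 then 1 else 0 := by
  split_ifs with hj
  · simp [hj]
  · obtain ⟨σ, -, hσ⟩ := exists_pow_eq_one_zpow_ne_one (k := 2 * j.natAbs) (j := j)
      (by lia) (fun h => by
        have := Int.natAbs_dvd_natAbs.2 h
        rw [Int.natAbs_natCast] at this
        have := Nat.le_of_dvd (by lia) this
        lia)
    have h := integral_mul_left_eq_self (μ := circleHaar) (fun τ : UnitCircle => (τ : ℂ) ^ j) σ
    simp only [Metric.unitSphere.coe_mul, mul_zpow] at h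
    rw [integral_const_mul] at h
    have h' : ((σ : ℂ) ^ j - 1) * ∫ τ : UnitCircle, (τ : ℂ) ^ j ∂circleHaar = 0 := by
      rw [sub_mul, h, one_mul, sub_self]
    rcases mul_eq_zero.1 h' with h1 | h1
    · exact absurd (sub_eq_zero.1 h1) hσ
    · exact h1

/-- The analytic Dirichlet kernel `1 + z + ⋯ + z ^ (n - 1)`. -/
def geomKernel (n : ℕ) (z : ℂ) : ℂ := ∑ k ∈ Finset.range n, z ^ k

@[fun_prop]
lemma continuous_geomKernel (n : ℕ) : Continuous (geomKernel n) := by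
  unfold geomKernel; fun_prop

lemma star_geomKernel (n : ℕ) (τ : UnitCircle) :
    (starRingEnd ℂ) (geomKernel n τ) = ∑ k ∈ Finset.range n, (τ : ℂ) ^ (-(k : ℤ)) := by
  simp [geomKernel, map_sum, ← Complex.inv_eq_conj (norm_coe τ)]

/-- Pairing with the Dirichlet kernel evaluates polynomials of low degree at `1`. -/
lemma integral_eval_mul_star_geomKernel {q : Polynomial ℂ} {N : ℕ} (hq : q.natDegree < N) :
    ∫ τ : UnitCircle, q.eval (τ : ℂ) * (starRingEnd ℂ) (geomKernel N τ) ∂circleHaar = q.eval 1 := by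
  have h : ∀ τ : UnitCircle, q.eval (τ : ℂ) * (starRingEnd ℂ) (geomKernel N τ) =
      ∑ a ∈ Finset.range N, ∑ b ∈ Finset.range N, q.coeff a * (τ : ℂ) ^ ((a : ℤ) - b) := by
    intro τ
    rw [star_geomKernel, Polynomial.eval_eq_sum_range' hq, Finset.sum_mul_sum]
    refine Finset.sum_congr rfl fun a _ => Finset.sum_congr rfl fun b _ => ?_
    rw [sub_eq_add_neg, zpow_add₀ (coe_ne_zero τ), zpow_natCast, mul_assoc]
  simp_rw [h]
  rw [integral_finsetSum _ fun a _ => integrable_circleHaar (continuous_finsetSum _ fun b _ =>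
    continuous_const.fun_mul (continuous_coe_zpow _)), Polynomial.eval_eq_sum_range' hq]
  refine Finset.sum_congr rfl fun a ha => ?_
  rw [integral_finsetSum _ fun b _ => integrable_circleHaar
    (continuous_const.fun_mul (continuous_coe_zpow _))]
  simp_rw [integral_const_mul, integral_circle_zpow, sub_eq_zero, Nat.cast_inj]
  simp [Finset.mem_range.1 ha]

lemma natDegree_geomSum_pow_lt {n : ℕ} (hn : n ≠ 0) (s : ℕ) :
    ((∑ i ∈ Finset.range n, (Polynomial.X : Polynomial ℂ) ^ i) ^ (s + 1)).natDegree
      < (s + 1) * n := by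
  refine lt_of_le_of_lt (Polynomial.natDegree_pow_le_of_le (s + 1) (?_ : _ ≤ n - 1))
    (Nat.mul_lt_mul_of_pos_left (by lia) (by lia))
  refine Polynomial.natDegree_sum_le_of_forall_le _ _ fun i hi => ?_
  rw [Polynomial.natDegree_X_pow]
  have := Finset.mem_range.1 hi
  lia

lemma integral_norm_geomKernel_sq {n : ℕ} (hn : n ≠ 0) :
    ∫ τ : UnitCircle, ‖geomKernel n τ‖ ^ 2 ∂circleHaar = n := by
  have h := integral_eval_mul_star_geomKernel (natDegree_geomSum_pow_lt hn 0)
  rw [zero_add, one_mul, pow_one] at h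
  have e : ∀ τ : UnitCircle, (∑ i ∈ Finset.range n, (Polynomial.X : Polynomial ℂ) ^ i).eval (τ : ℂ) *
      (starRingEnd ℂ) (geomKernel n τ) = ((‖geomKernel n τ‖ ^ 2 : ℝ) : ℂ) := by
    intro τ
    rw [Polynomial.eval_finsetSum]
    simp only [Polynomial.eval_pow, Polynomial.eval_X]
    rw [← geomKernel, Complex.mul_conj, Complex.normSq_eq_norm_sq]
  simp_rw [e] at h
  rw [integral_complex_ofReal] at h
  simpa [Polynomial.eval_finsetSum, ← Complex.ofReal_natCast] using h

lemma le_integral_norm_geomKernel_pow {n : ℕ} (hn : n ≠ 0) (m : ℕ) :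
    (n : ℝ) ^ (2 * m + 1) ≤
      (m + 1) * ∫ τ : UnitCircle, ‖geomKernel n τ‖ ^ (2 * (m + 1)) ∂circleHaar := by
  set N := (m + 1) * n with hN
  have hN0 : N ≠ 0 := by positivity
  have h := integral_eval_mul_star_geomKernel (natDegree_geomSum_pow_lt hn m)
  have e1 : ∀ z : ℂ, ((∑ i ∈ Finset.range n, (Polynomial.X : Polynomial ℂ) ^ i) ^ (m + 1)).eval z
      = geomKernel n z ^ (m + 1) := by
    intro z
    simp [Polynomial.eval_finsetSum, geomKernel]
  simp_rw [e1] at h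
  have hre : ∫ τ : UnitCircle, (geomKernel n τ ^ (m + 1) * (starRingEnd ℂ) (geomKernel N τ)).re
      ∂circleHaar = (n : ℝ) ^ (m + 1) := by
    have h1 := congrArg Complex.re h
    have h2 : geomKernel n 1 = ((n : ℝ) : ℂ) := by simp [geomKernel]
    rw [h2, ← Complex.ofReal_pow, Complex.ofReal_re] at h1
    rw [← h1]
    exact integral_re (𝕜 := ℂ) (f := fun τ : UnitCircle =>
      geomKernel n τ ^ (m + 1) * (starRingEnd ℂ) (geomKernel N τ))
      (integrable_circleHaar (by fun_prop))
  set c : ℝ := (n : ℝ) ^ (m + 1) / N with hc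
  have hpt : ∀ τ : UnitCircle, 2 * c * (geomKernel n τ ^ (m + 1) *
      (starRingEnd ℂ) (geomKernel N τ)).re - c ^ 2 * ‖geomKernel N τ‖ ^ 2 ≤
        ‖geomKernel n τ‖ ^ (2 * (m + 1)) := by
    intro τ
    have h1 := sq_nonneg (‖geomKernel n τ ^ (m + 1)‖ - c * ‖geomKernel N τ‖)
    have h2 := Complex.re_le_norm (geomKernel n τ ^ (m + 1) * (starRingEnd ℂ) (geomKernel N τ))
    rw [norm_mul, RCLike.norm_conj] at h2
    have hc0 : 0 ≤ c := by positivity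
    have h3 := mul_le_mul_of_nonneg_left h2 hc0
    rw [pow_mul', ← norm_pow (geomKernel n _)]
    nlinarith
  have hint := integral_mono
    (integrable_circleHaar (by fun_prop)) (integrable_circleHaar (by fun_prop)) hpt
  rw [integral_sub (integrable_circleHaar (by fun_prop)) (integrable_circleHaar (by fun_prop)),
    integral_const_mul, integral_const_mul, hre, integral_norm_geomKernel_sq hN0] at hint
  have hn' : (0 : ℝ) < n := by positivity
  refine le_trans (le_of_eq ?_) (mul_le_mul_of_nonneg_left hint (by positivity))
  rw [hc, hN]
  push_cast
  field_simp
  ring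

lemma norm_geomKernel_mul_norm_one_sub_le (n : ℕ) (τ : UnitCircle) :
    ‖geomKernel n τ‖ * ‖1 - (τ : ℂ)‖ ≤ 2 := by
  rw [← norm_mul, geomKernel, geom_sum_mul_neg]
  refine (norm_sub_le _ _).trans ?_
  simp only [norm_one, norm_pow, norm_coe, one_pow]
  norm_num

/-- The moment estimate for the generalized Jackson kernel. -/
lemma integral_jackson_moment_le {α : ℝ} {m : ℕ} (hα : 0 ≤ α) (hαm : α ≤ 2 * m) {n : ℕ}
    (hn : n ≠ 0) :
    ∫ τ : UnitCircle, ‖geomKernel n τ‖ ^ (2 * (m + 1)) * ‖1 - (τ : ℂ)‖ ^ α ∂circleHaar ≤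
      (1 + 4 ^ m * (m + 1)) * (n : ℝ) ^ (-α) *
        ∫ τ : UnitCircle, ‖geomKernel n τ‖ ^ (2 * (m + 1)) ∂circleHaar := by
  have hn' : (0 : ℝ) < n := by positivity
  have hpt : ∀ τ : UnitCircle, ‖geomKernel n τ‖ ^ (2 * (m + 1)) * ‖1 - (τ : ℂ)‖ ^ α ≤
      (n : ℝ) ^ (-α) * (‖geomKernel n τ‖ ^ (2 * (m + 1)) +
        4 ^ m * (n : ℝ) ^ (2 * m) * ‖geomKernel n τ‖ ^ 2) := by
    intro τ
    set d := ‖geomKernel n τ‖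
    set x := ‖1 - (τ : ℂ)‖
    have hx : 0 ≤ x := norm_nonneg _
    have hd : 0 ≤ d := norm_nonneg _
    have h1 : x ^ α = (n : ℝ) ^ (-α) * (n * x) ^ α := by
      rw [Real.mul_rpow hn'.le hx, ← mul_assoc, ← Real.rpow_add hn']
      simp
    have h2 : (n * x) ^ α ≤ 1 + (n * x) ^ (2 * m) := by
      have hy : 0 ≤ n * x := by positivity
      rcases le_total (n * x) 1 with h | h
      · have := Real.rpow_le_one hy h hα
        have : 0 ≤ (n * x) ^ (2 * m) := by positivity
        linarith
      · have := Real.rpow_le_rpow_of_exponent_le h hαm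
        rw [show (2 * m : ℝ) = ((2 * m : ℕ) : ℝ) by push_cast; rfl, Real.rpow_natCast] at this
        linarith
    have h3 : (d * x) ^ (2 * m) ≤ 4 ^ m := by
      rw [show (4 : ℝ) = 2 ^ 2 by norm_num, ← pow_mul]
      exact pow_le_pow_left₀ (by positivity) (norm_geomKernel_mul_norm_one_sub_le n τ) _
    calc d ^ (2 * (m + 1)) * x ^ α
        = (n : ℝ) ^ (-α) * (d ^ (2 * (m + 1)) * (n * x) ^ α) := by rw [h1]; ring
      _ ≤ (n : ℝ) ^ (-α) * (d ^ (2 * (m + 1)) * (1 + (n * x) ^ (2 * m))) := by gcongr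
      _ = (n : ℝ) ^ (-α) * (d ^ (2 * (m + 1)) +
            (d * x) ^ (2 * m) * (n : ℝ) ^ (2 * m) * d ^ 2) := by ring
      _ ≤ _ := by gcongr
  have hint := integral_mono
    (integrable_circleHaar (by exact (by fun_prop : Continuous _).mul ((by fun_prop : Continuous _).rpow_const fun _ => Or.inr hα)))
    (integrable_circleHaar (by fun_prop)) hpt
  rw [integral_const_mul, integral_add (integrable_circleHaar (by fun_prop))
    (integrable_circleHaar (by fun_prop)), integral_const_mul,
    integral_norm_geomKernel_sq hn] at hint
  refine hint.trans ?_
  have hlow := le_integral_norm_geomKernel_pow hn m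
  set I := ∫ τ : UnitCircle, ‖geomKernel n τ‖ ^ (2 * (m + 1)) ∂circleHaar
  calc (n : ℝ) ^ (-α) * (I + 4 ^ m * (n : ℝ) ^ (2 * m) * n)
      = (n : ℝ) ^ (-α) * (I + 4 ^ m * (n : ℝ) ^ (2 * m + 1)) := by ring
    _ ≤ (n : ℝ) ^ (-α) * (I + 4 ^ m * ((m + 1) * I)) := by gcongr
    _ = _ := by ring

lemma exists_trigPoly_zpow_mul {N M : ℕ} {j : ℤ} (hj : j.natAbs ≤ M) {p : ℂ → ℂ}
    (hp : p ∈ trigPoly N) :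
    ∃ q ∈ trigPoly (N + M), ∀ τ : UnitCircle, q τ = (τ : ℂ) ^ j * p τ := by
  induction hp using Submodule.span_induction with
  | mem p hp =>
    obtain ⟨i, hi, rfl⟩ := hp
    refine ⟨fun z => z ^ (j + i), zpow_mem_trigPoly ?_, fun τ => zpow_add₀ (coe_ne_zero τ) _ _⟩
    have : i.natAbs ≤ N := hi
    lia
  | zero => exact ⟨0, Submodule.zero_mem _, by simp⟩
  | add p q _ _ ihp ihq =>
    obtain ⟨p', hp, hp'⟩ := ihp
    obtain ⟨q', hq, hq'⟩ := ihq
    exact ⟨p' + q', Submodule.add_mem _ hp hq, fun τ => by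
      rw [Pi.add_apply, Pi.add_apply, hp', hq', mul_add]⟩
  | smul c p _ ihp =>
    obtain ⟨p', hp, hp'⟩ := ihp
    exact ⟨c • p', Submodule.smul_mem _ c hp, fun τ => by
      rw [Pi.smul_apply, Pi.smul_apply, hp', smul_eq_mul, smul_eq_mul, mul_left_comm]⟩

lemma norm_geomKernel_sq_eq_sum (n : ℕ) (τ : UnitCircle) :
    ((‖geomKernel n τ‖ ^ 2 : ℝ) : ℂ) =
      ∑ a ∈ Finset.range n, ∑ b ∈ Finset.range n, (τ : ℂ) ^ ((a : ℤ) - b) := by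
  rw [← Complex.normSq_eq_norm_sq, ← Complex.mul_conj, star_geomKernel, geomKernel,
    Finset.sum_mul_sum]
  refine Finset.sum_congr rfl fun a _ => Finset.sum_congr rfl fun b _ => ?_
  rw [sub_eq_add_neg, zpow_add₀ (coe_ne_zero τ), zpow_natCast]

/-- The generalized Jackson kernel is a trigonometric polynomial. -/
lemma exists_trigPoly_eq_norm_geomKernel_pow (n s : ℕ) :
    ∃ K ∈ trigPoly (s * n), ∀ τ : UnitCircle,
      K τ = ((‖geomKernel n τ‖ ^ (2 * s) : ℝ) : ℂ) := by
  induction s with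
  | zero => exact ⟨_, zpow_mem_trigPoly (j := 0) (by simp), by simp⟩
  | succ s ih =>
    obtain ⟨K, hK, hK'⟩ := ih
    have h : ∀ a b : Fin n, ∃ q ∈ trigPoly (s * n + n), ∀ τ : UnitCircle,
        q τ = (τ : ℂ) ^ ((a : ℤ) - (b : ℤ)) * K τ := fun a b =>
      exists_trigPoly_zpow_mul (by have := a.isLt; have := b.isLt; lia) hK
    choose q hq hq' using h
    refine ⟨∑ a, ∑ b, q a b, ?_, fun τ => ?_⟩
    · rw [Nat.succ_mul]
      exact Submodule.sum_mem _ fun a _ => Submodule.sum_mem _ fun b _ => hq a b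
    · rw [mul_add, mul_one, pow_add, Complex.ofReal_mul, ← hK', norm_geomKernel_sq_eq_sum,
        mul_comm]
      simp only [Finset.sum_apply, hq', ← Finset.sum_mul, Finset.sum_range]

lemma cdiff_iterate_eq_sum (τ : ℂ) (f : ℂ → ℂ) (m : ℕ) (z : ℂ) :
    (cdiff τ)^[m] f z =
      ∑ k ∈ Finset.range (m + 1), ((-1 : ℂ) ^ (m - k) * m.choose k) * f (τ ^ k * z) := by
  have h : ∀ (m : ℕ) (f : ℂ → ℂ), (cdiff τ)^[m] f =
      fun z => (fwdDiff (Additive.ofMul τ))^[m] (fun x => f x.toMul) (Additive.ofMul z) := by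
    intro m
    induction m with
    | zero => intro f; rfl
    | succ m ih =>
      intro f
      rw [Function.iterate_succ_apply, ih]
      funext z
      rw [Function.iterate_succ_apply]
      refine congrFun (congrArg _ (funext fun x => ?_)) _
      simp [cdiff, fwdDiff, mul_comm]
  simp only [h]
  rw [fwdDiff_iter_eq_sum_shift]
  refine Finset.sum_congr rfl fun k _ => ?_
  simp [mul_comm]

/-- **Jackson's theorem** for the Hölder–Zygmund classes on the circle. -/
lemma exists_trigPoly_norm_sub_le {α : ℝ} (hα : 0 < α) {f : ℂ → ℂ} (hf : MemHZCircle α f) :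
    ∃ B : ℝ, 0 ≤ B ∧ ∀ n : ℕ, n ≠ 0 → ∃ p ∈ trigPoly ((⌊α⌋₊ + 1 + 1) * n),
      ∀ z : UnitCircle, ‖f z - p z‖ ≤ B * (n : ℝ) ^ (-α) := by
  obtain ⟨hc, C, hC, hfC⟩ := hf
  set m := ⌊α⌋₊ + 1 with hm
  have hαm : α ≤ 2 * (m : ℝ) := by
    have := Nat.lt_floor_add_one α
    rw [hm]
    push_cast
    linarith [Nat.cast_nonneg (α := ℝ) ⌊α⌋₊]
  refine ⟨C * (1 + 4 ^ m * (m + 1)), by positivity, fun n hn => ?_⟩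
  obtain ⟨K, hK, hK'⟩ := exists_trigPoly_eq_norm_geomKernel_pow n (m + 1)
  choose P hP hP' using fun k : ℕ => exists_trigPoly_eq_integral hc k.succ_ne_zero hK
  set I := ∫ τ : UnitCircle, ‖geomKernel n τ‖ ^ (2 * (m + 1)) ∂circleHaar with hI
  have hI0 : 0 < I := by
    have h := le_integral_norm_geomKernel_pow hn m
    have h' : (0 : ℝ) < (n : ℝ) ^ (2 * m + 1) := by positivity
    exact pos_of_mul_pos_right (h'.trans_le h) (by positivity)
  have hIK : ∫ τ : UnitCircle, K τ ∂circleHaar = I := by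
    simp_rw [hK']
    exact integral_complex_ofReal
  let a : ℕ → ℂ := fun k => (-1 : ℂ) ^ (m - k) * m.choose k
  have ha : a 0 * a 0 = 1 := by
    simp only [a, Nat.sub_zero, Nat.choose_zero_right, Nat.cast_one, mul_one, ← mul_pow]
    norm_num
  have ha' : ‖a 0‖ = 1 := by simp [a]
  have hKc : Continuous fun τ : UnitCircle => K τ :=
    (continuousOn_of_mem_trigPoly hK).comp_continuous continuous_subtype_val (by simp)
  have hfc : ∀ (k : ℕ) (z : UnitCircle), Continuous fun τ : UnitCircle => f ((τ : ℂ) ^ k * z) :=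
    fun k z => hc.comp_continuous (by fun_prop) (by simp)
  refine ⟨-(a 0 / I) • ∑ k ∈ Finset.range m, a (k + 1) • P k, Submodule.smul_mem _ _
    (Submodule.sum_mem _ fun k _ => Submodule.smul_mem _ _ (hP k)), fun z => ?_⟩
  have hint : ∫ τ : UnitCircle, K τ * (cdiff τ)^[m] f z ∂circleHaar =
      ∑ k ∈ Finset.range m, a (k + 1) * P k z + a 0 * (I * f z) := by
    have e : ∀ τ : UnitCircle, K τ * (cdiff τ)^[m] f z =
        ∑ k ∈ Finset.range m, a (k + 1) * (K τ * f ((τ : ℂ) ^ (k + 1) * z)) +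
          a 0 * (K τ * f z) := by
      intro τ
      rw [cdiff_iterate_eq_sum, Finset.sum_range_succ', mul_add, Finset.mul_sum, pow_zero, one_mul]
      congr 1
      · exact Finset.sum_congr rfl fun k _ => mul_left_comm _ _ _
      · exact mul_left_comm _ _ _
    simp_rw [e]
    have hi : ∀ k, Integrable
        (fun τ : UnitCircle => a (k + 1) * (K τ * f ((τ : ℂ) ^ (k + 1) * z))) circleHaar :=
      fun k => integrable_circleHaar (continuous_const.fun_mul (hKc.fun_mul (hfc _ z)))
    rw [integral_add (integrable_finsetSum _ fun k _ => hi k)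
      (integrable_circleHaar (continuous_const.fun_mul (hKc.fun_mul continuous_const))),
      integral_finsetSum _ fun k _ => hi k,
      integral_const_mul, integral_mul_const, hIK]
    congr 1
    exact Finset.sum_congr rfl fun k _ => by rw [integral_const_mul, hP']
  have hIC : (I : ℂ) ≠ 0 := by exact_mod_cast hI0.ne'
  have hfp : f z - (-(a 0 / I) • ∑ k ∈ Finset.range m, a (k + 1) • P k) z =
      a 0 / I * ∫ τ : UnitCircle, K τ * (cdiff τ)^[m] f z ∂circleHaar := by
    rw [hint]
    simp only [Pi.smul_apply, Finset.sum_apply, smul_eq_mul]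
    field_simp
    linear_combination (-(I : ℂ) * f z) * ha
  have hbound : ‖∫ τ : UnitCircle, K τ * (cdiff τ)^[m] f z ∂circleHaar‖ ≤
      C * ((1 + 4 ^ m * (m + 1)) * (n : ℝ) ^ (-α) * I) := by
    refine le_trans ?_
      (mul_le_mul_of_nonneg_left (integral_jackson_moment_le hα.le hαm hn) hC)
    rw [← integral_const_mul]
    refine norm_integral_le_of_norm_le (integrable_circleHaar ?_)
      (Filter.Eventually.of_forall fun τ => ?_)
    · exact continuous_const.mul ((by fun_prop : Continuous _).mul
        ((by fun_prop : Continuous _).rpow_const fun _ => Or.inr hα.le))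
    · rw [norm_mul, hK', Complex.norm_real, Real.norm_of_nonneg (by positivity), mul_left_comm]
      exact mul_le_mul_of_nonneg_left (hfC z τ (norm_coe z) (norm_coe τ)) (by positivity)
  rw [hfp, norm_mul, norm_div, ha', Complex.norm_real, Real.norm_of_nonneg hI0.le]
  refine (mul_le_mul_of_nonneg_left hbound (by positivity)).trans_eq ?_
  field_simp

end CircleMean

section SingularValues

variable {H : Type} [NormedAddCommGroup H] [InnerProductSpace ℂ H] [CompleteSpace H]

lemma sVal_nonneg (T : H →L[ℂ] H) (j : ℕ) : 0 ≤ sVal T j := by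
  refine Real.sInf_nonneg ?_
  rintro _ ⟨R, -, rfl⟩
  exact norm_nonneg _

lemma sVal_le_norm_sub {T R : H →L[ℂ] H} {j : ℕ}
    (hR : LinearMap.rank (R : H →ₗ[ℂ] H) ≤ (j : Cardinal)) : sVal T j ≤ ‖T - R‖ := by
  refine csInf_le ⟨0, ?_⟩ ⟨R, hR, rfl⟩
  rintro _ ⟨R, -, rfl⟩
  exact norm_nonneg _

lemma norm_cfc_sub_cfc_le {T : H →L[ℂ] H} (hT : T ∈ unitary (H →L[ℂ] H)) {f p : ℂ → ℂ}
    (hf : ContinuousOn f (Metric.sphere (0 : ℂ) 1))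
    (hp : ContinuousOn p (Metric.sphere (0 : ℂ) 1)) {b : ℝ} (hb : 0 ≤ b)
    (h : ∀ z : UnitCircle, ‖f z - p z‖ ≤ b) : ‖cfc f T - cfc p T‖ ≤ b := by
  have hsub := spectrum.subset_circle_of_unitary (𝕜 := ℂ) hT
  rw [← cfc_sub f p T (hf.mono hsub) (hp.mono hsub)]
  exact norm_cfc_le hb fun z hz => h ⟨z, hsub hz⟩

end SingularValues

theorem stmt12 (α : ℝ) (hα : 0 < α)
    (H : Type) [NormedAddCommGroup H] [InnerProductSpace ℂ H] [CompleteSpace H]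
    [TopologicalSpace.SeparableSpace H]
    (U V : H →L[ℂ] H) (hU : U ∈ unitary (H →L[ℂ] H)) (hV : V ∈ unitary (H →L[ℂ] H))
    (hrank : LinearMap.rank ((U - V : H →L[ℂ] H) : H →ₗ[ℂ] H) < Cardinal.aleph0) :
    ∀ f : ℂ → ℂ, MemHZCircle α f →
      MemWeakSchatten (1 / α) (cfc f U - cfc f V) := by
  intro f hf
  obtain ⟨B, hB, hJ⟩ := exists_trigPoly_norm_sub_le hα hf
  obtain ⟨r, hr⟩ := Cardinal.lt_aleph0.1 hrank
  set T := cfc f U - cfc f V with hT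
  set A : ℕ := 2 * (⌊α⌋₊ + 1 + 1) * r + 1 with hA
  have hα' : 0 ≤ 1 / α := by positivity
  refine ⟨A * ‖T‖ ^ (1 / α) + 2 * A * (2 * B) ^ (1 / α), fun j => ?_⟩
  have hdiv : A * (j / A) ≤ j := Nat.mul_div_le j A
  have hlt : j < A * (j / A) + A := Nat.lt_mul_div_succ j (by lia)
  rcases eq_or_ne (j / A) 0 with hn | hn
  · rw [hn, mul_zero, zero_add] at hlt
    have h1 : sVal T j ≤ ‖T‖ := by
      simpa using sVal_le_norm_sub (T := T) (R := 0) (j := j) (by simp [LinearMap.rank_zero])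
    have h2 : (1 + (j : ℝ)) ≤ A := by
      rw [add_comm]
      exact_mod_cast hlt
    have h3 := mul_le_mul h2 (Real.rpow_le_rpow (sVal_nonneg T j) h1 hα')
      (Real.rpow_nonneg (sVal_nonneg T j) _) (by positivity)
    have h4 : 0 ≤ 2 * A * (2 * B) ^ (1 / α) := by positivity
    linarith
  · set n := j / A
    have hn' : (0 : ℝ) < n := by positivity
    obtain ⟨p, hp, hfp⟩ := hJ n hn
    have hpc := continuousOn_of_mem_trigPoly hp
    have hb : 0 ≤ B * (n : ℝ) ^ (-α) := by positivity
    have hR : LinearMap.rank ((cfc p U - cfc p V : H →L[ℂ] H) : H →ₗ[ℂ] H) ≤ (j : Cardinal) := by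
      refine (rank_cfc_sub_cfc_le hU hV hp).trans ?_
      rw [hr]
      have : 2 * ((⌊α⌋₊ + 1 + 1) * n) * r ≤ j := by
        refine le_trans ?_ hdiv
        rw [hA]
        nlinarith
      exact_mod_cast this
    have h1 : sVal T j ≤ 2 * B * (n : ℝ) ^ (-α) := by
      refine (sVal_le_norm_sub hR).trans ?_
      rw [hT, sub_sub_sub_comm]
      refine (norm_sub_le _ _).trans ?_
      linarith [norm_cfc_sub_cfc_le hU hf.1 hpc hb hfp, norm_cfc_sub_cfc_le hV hf.1 hpc hb hfp]
    have h2 : (1 + (j : ℝ)) ≤ 2 * A * n := by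
      have : 1 + j ≤ 2 * A * n := by
        have := Nat.le_mul_of_pos_right A (Nat.pos_of_ne_zero hn)
        lia
      exact_mod_cast this
    have h3 := mul_le_mul h2 (Real.rpow_le_rpow (sVal_nonneg T j) h1 hα')
      (Real.rpow_nonneg (sVal_nonneg T j) _) (by positivity)
    have h4 : (2 * B * (n : ℝ) ^ (-α)) ^ (1 / α) = (2 * B) ^ (1 / α) * (n : ℝ)⁻¹ := by
      rw [Real.mul_rpow (by positivity) (by positivity), ← Real.rpow_mul hn'.le,
        show -α * (1 / α) = -1 by field_simp, Real.rpow_neg_one]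
    have h5 : 0 ≤ A * ‖T‖ ^ (1 / α) := by positivity
    rw [h4] at h3
    have h6 : 2 * (A : ℝ) * n * ((2 * B) ^ (1 / α) * (n : ℝ)⁻¹) =
        2 * A * (2 * B) ^ (1 / α) := by
      field_simp
    linarith
end
end

section
/- Let α > 0. There exist unitary operators U and V on a separable Hilbert space and a real-valued function h in the Hölder–Zygmund class Λ_α on the unit circle such that rank(U − V) = 1 and s_m(h(U) − h(V)) ≥ (1 + m)^{−α} for every m ≥ 0. -/
open scoped BigOperators
noncomputable section

/-- A concrete separable Hilbert space: `ℓ²(ℕ)`. -/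
abbrev ellTwo : Type := lp (fun _ : ℕ => ℂ) 2

open Filter Topology ComplexConjugate

/-- The iterated difference operator only involves values on the circle, so it is continuous with
respect to pointwise convergence on the circle. -/
theorem tendsto_cdiff_iterate {τ : ℂ} (hτ : ‖τ‖ = 1) {F : ℕ → ℂ → ℂ} {f : ℂ → ℂ}
    (hF : ∀ ζ : ℂ, ‖ζ‖ = 1 → Tendsto (fun N => F N ζ) atTop (𝓝 (f ζ))) (m : ℕ) :
    ∀ ζ : ℂ, ‖ζ‖ = 1 →
      Tendsto (fun N => (cdiff τ)^[m] (F N) ζ) atTop (𝓝 ((cdiff τ)^[m] f ζ)) := by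
  induction m with
  | zero => exact hF
  | succ m ih =>
    intro ζ hζ
    simp only [Function.iterate_succ_apply', cdiff]
    exact (ih (τ * ζ) (by simp [hτ, hζ])).sub (ih ζ hζ)

/-- The lacunary trigonometric series `∑ c_n (ζ^{2^n} + conj ζ^{2^n})`. -/
def lacunary (c : ℕ → ℝ) (ζ : ℂ) : ℂ :=
  ∑' n, (c n : ℂ) * (ζ ^ 2 ^ n + conj (ζ ^ 2 ^ n))

/-- The partial sums of `lacunary c`. -/
def lacunaryPartial (c : ℕ → ℝ) (N : ℕ) (ζ : ℂ) : ℂ :=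
  ∑ n ∈ Finset.range N, (c n : ℂ) * (ζ ^ 2 ^ n + conj (ζ ^ 2 ^ n))

theorem tendstoUniformlyOn_lacunaryPartial {c : ℕ → ℝ} (hc : Summable c) (hc0 : ∀ n, 0 ≤ c n) :
    TendstoUniformlyOn (lacunaryPartial c) (lacunary c) atTop (Metric.sphere (0 : ℂ) 1) := by
  refine tendstoUniformlyOn_tsum_nat (u := fun n => c n * 2) (hc.mul_right 2) ?_
  intro n ζ hζ
  have hζ : ‖ζ‖ = 1 := by simpa using hζ
  rw [norm_mul, Complex.norm_real, Real.norm_of_nonneg (hc0 n)]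
  gcongr
  · exact hc0 n
  refine (norm_add_le _ _).trans (le_of_eq ?_)
  simp [hζ]
  norm_num

theorem continuous_lacunaryPartial (c : ℕ → ℝ) (N : ℕ) : Continuous (lacunaryPartial c N) := by
  unfold lacunaryPartial
  fun_prop

theorem lacunary_im {c : ℕ → ℝ} (ζ : ℂ) : (lacunary c ζ).im = 0 := by
  rw [← Complex.conj_eq_iff_im, lacunary, Complex.conj_tsum]
  refine tsum_congr fun n => ?_
  simp [add_comm]

theorem cdiff_iterate_lacunaryPartial (c : ℕ → ℝ) (N : ℕ) (τ : ℂ) (m : ℕ) (ζ : ℂ) :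
    (cdiff τ)^[m] (lacunaryPartial c N) ζ = ∑ n ∈ Finset.range N, (c n : ℂ) *
      ((τ ^ 2 ^ n - 1) ^ m * ζ ^ 2 ^ n + conj ((τ ^ 2 ^ n - 1) ^ m * ζ ^ 2 ^ n)) := by
  induction m generalizing ζ with
  | zero => simp [lacunaryPartial]
  | succ m ih =>
    rw [Function.iterate_succ_apply', cdiff, ih, ih, ← Finset.sum_sub_distrib]
    refine Finset.sum_congr rfl fun n _ => ?_
    simp only [map_mul, map_pow, map_sub, map_one, mul_pow]
    ring

theorem norm_pow_sub_one_le_mul {τ : ℂ} (hτ : ‖τ‖ = 1) (p : ℕ) :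
    ‖τ ^ p - 1‖ ≤ p * ‖1 - τ‖ := by
  induction p with
  | zero => simp
  | succ p ih =>
    have h : τ ^ (p + 1) - 1 = τ * (τ ^ p - 1) - (1 - τ) := by ring
    rw [h]
    refine (norm_sub_le _ _).trans ?_
    rw [norm_mul, hτ]
    push_cast
    linarith

theorem norm_pow_sub_one_le_two {τ : ℂ} (hτ : ‖τ‖ = 1) (p : ℕ) : ‖τ ^ p - 1‖ ≤ 2 := by
  refine (norm_sub_le _ _).trans (le_of_eq ?_)
  simp [hτ]
  norm_num

theorem norm_cdiff_iterate_lacunaryPartial_le {c : ℕ → ℝ} (hc0 : ∀ n, 0 ≤ c n) (N : ℕ) {τ : ℂ}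
    (hτ : ‖τ‖ = 1) (m : ℕ) {ζ : ℂ} (hζ : ‖ζ‖ = 1) :
    ‖(cdiff τ)^[m] (lacunaryPartial c N) ζ‖ ≤
      2 * ∑ n ∈ Finset.range N, c n * min 2 (2 ^ n * ‖1 - τ‖) ^ m := by
  rw [cdiff_iterate_lacunaryPartial, Finset.mul_sum]
  refine norm_sum_le_of_le _ fun n _ => ?_
  have h : ‖τ ^ 2 ^ n - 1‖ ≤ min 2 (2 ^ n * ‖1 - τ‖) :=
    le_min (norm_pow_sub_one_le_two hτ _) (by simpa using norm_pow_sub_one_le_mul hτ (2 ^ n))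
  have h' : ‖(τ ^ 2 ^ n - 1) ^ m * ζ ^ 2 ^ n‖ ≤ min 2 (2 ^ n * ‖1 - τ‖) ^ m := by
    rw [norm_mul, norm_pow, norm_pow, hζ, one_pow, mul_one]
    gcongr
  rw [norm_mul, Complex.norm_real, Real.norm_of_nonneg (hc0 n)]
  have h2 := norm_add_le ((τ ^ 2 ^ n - 1) ^ m * ζ ^ 2 ^ n) (conj ((τ ^ 2 ^ n - 1) ^ m * ζ ^ 2 ^ n))
  rw [Complex.norm_conj] at h2
  have := mul_le_mul_of_nonneg_left (h2.trans (add_le_add h' h')) (hc0 n)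
  linarith

/-- The dyadic sum estimate behind the Hölder–Zygmund bound for lacunary series. -/
theorem sum_geometric_mul_min_pow_le {α : ℝ} (hα : 0 < α) {m : ℕ} (hm : α < m) {δ : ℝ}
    (hδ : 0 < δ) (hδ2 : δ ≤ 2) (M : ℕ) :
    ∑ n ∈ Finset.range M, ((2 : ℝ) ^ (-α)) ^ n * min 2 (2 ^ n * δ) ^ m ≤
      2 ^ m * (2 ^ m * 2 ^ (-α) / (2 ^ m * 2 ^ (-α) - 1) + 1 / (1 - 2 ^ (-α))) * δ ^ α := by
  set q : ℝ := (2 : ℝ) ^ (-α) with hq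
  have hq0 : 0 < q := by positivity
  have hq1 : q < 1 := Real.rpow_lt_one_of_one_lt_of_neg one_lt_two (by linarith)
  set ρ : ℝ := 2 ^ m * q with hρ
  have hρ1 : 1 < ρ := by
    rw [hρ, hq, ← Real.rpow_natCast, ← Real.rpow_add two_pos]
    exact Real.one_lt_rpow one_lt_two (by linarith)
  obtain ⟨N, hN, hN'⟩ := exists_nat_pow_near (x := 2 / δ) (y := (2 : ℝ))
    (by rw [le_div_iff₀ hδ]; linarith) one_lt_two
  rw [le_div_iff₀ hδ] at hN
  have hqN : q ^ N ≤ δ ^ α := by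
    have h1 : q ^ (N + 1) = ((2 : ℝ) ^ (N + 1)) ^ (-α) := by
      rw [hq, ← Real.rpow_natCast, ← Real.rpow_natCast, ← Real.rpow_mul two_pos.le,
        ← Real.rpow_mul two_pos.le, mul_comm]
    have h2 : ((2 : ℝ) ^ (N + 1)) ^ (-α) ≤ (2 / δ) ^ (-α) :=
      Real.rpow_le_rpow_of_nonpos (by positivity) hN'.le (by linarith)
    have h3 : ((2 : ℝ) / δ) ^ (-α) = q * δ ^ α := by
      rw [Real.div_rpow two_pos.le hδ.le, Real.rpow_neg hδ.le, div_inv_eq_mul]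
    rw [h3, ← h1, pow_succ'] at h2
    exact le_of_mul_le_mul_left h2 hq0
  have hlow : ∑ n ∈ Finset.range (N + 1), q ^ n * min 2 (2 ^ n * δ) ^ m ≤
      2 ^ m * q ^ N * (ρ / (ρ - 1)) := by
    calc ∑ n ∈ Finset.range (N + 1), q ^ n * min 2 (2 ^ n * δ) ^ m
        ≤ ∑ n ∈ Finset.range (N + 1), δ ^ m * ρ ^ n := by
          refine Finset.sum_le_sum fun n _ => ?_
          calc q ^ n * min 2 (2 ^ n * δ) ^ m ≤ q ^ n * (2 ^ n * δ) ^ m := by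
                gcongr
                exact min_le_right _ _
            _ = δ ^ m * ρ ^ n := by rw [hρ]; ring
      _ = δ ^ m * ((ρ ^ (N + 1) - 1) / (ρ - 1)) := by
          rw [← Finset.mul_sum, geom_sum_eq hρ1.ne']
      _ ≤ δ ^ m * (ρ ^ (N + 1) / (ρ - 1)) := by
          have : 0 < ρ - 1 := by linarith
          gcongr
          linarith
      _ = (2 ^ N * δ) ^ m * q ^ N * (ρ / (ρ - 1)) := by
          rw [show ρ ^ (N + 1) / (ρ - 1) = ρ ^ N * (ρ / (ρ - 1)) by ring,
            show ρ ^ N = (2 ^ N) ^ m * q ^ N by rw [hρ]; ring]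
          ring
      _ ≤ 2 ^ m * q ^ N * (ρ / (ρ - 1)) := by
          have : 0 < ρ - 1 := by linarith
          gcongr
  have hhigh : ∑ n ∈ Finset.range M,
      q ^ (N + 1 + n) * min 2 (2 ^ (N + 1 + n) * δ) ^ m ≤ 2 ^ m * q ^ N * (1 / (1 - q)) := by
    calc ∑ n ∈ Finset.range M, q ^ (N + 1 + n) * min 2 (2 ^ (N + 1 + n) * δ) ^ m
        ≤ ∑ n ∈ Finset.range M, 2 ^ m * q ^ N * q ^ n := by
          refine Finset.sum_le_sum fun n _ => ?_
          calc q ^ (N + 1 + n) * min 2 (2 ^ (N + 1 + n) * δ) ^ m ≤ q ^ (N + n) * 2 ^ m := by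
                gcongr ?_ * ?_ ^ m
                · exact pow_le_pow_of_le_one hq0.le hq1.le (by omega)
                · exact min_le_left _ _
            _ = 2 ^ m * q ^ N * q ^ n := by ring
      _ ≤ 2 ^ m * q ^ N * (1 / (1 - q)) := by
          rw [← Finset.mul_sum]
          gcongr
          rw [one_div, ← tsum_geometric_of_lt_one hq0.le hq1]
          exact (summable_geometric_of_lt_one hq0.le hq1).sum_le_tsum _ fun _ _ => by positivity
  have hK : 0 ≤ 2 ^ m * (ρ / (ρ - 1) + 1 / (1 - q)) := by
    have : 0 < ρ - 1 := by linarith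
    have : 0 < 1 - q := by linarith
    positivity
  calc ∑ n ∈ Finset.range M, q ^ n * min 2 (2 ^ n * δ) ^ m
      ≤ ∑ n ∈ Finset.range (N + 1 + M), q ^ n * min 2 (2 ^ n * δ) ^ m :=
        Finset.sum_le_sum_of_subset_of_nonneg (Finset.range_mono (by omega))
          fun _ _ _ => by positivity
    _ ≤ 2 ^ m * q ^ N * (ρ / (ρ - 1)) + 2 ^ m * q ^ N * (1 / (1 - q)) := by
        rw [Finset.sum_range_add]
        exact add_le_add hlow hhigh
    _ = 2 ^ m * (ρ / (ρ - 1) + 1 / (1 - q)) * q ^ N := by ring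
    _ ≤ 2 ^ m * (ρ / (ρ - 1) + 1 / (1 - q)) * δ ^ α := by gcongr

theorem summable_const_mul_two_rpow_pow {α : ℝ} (hα : 0 < α) (A : ℝ) :
    Summable fun n : ℕ => A * ((2 : ℝ) ^ (-α)) ^ n :=
  (summable_geometric_of_lt_one (by positivity)
    (Real.rpow_lt_one_of_one_lt_of_neg one_lt_two (by linarith))).mul_left A

/-- A lacunary series with coefficients `A 2^{-nα}` lies in `Λ_α`. -/
theorem memHZCircle_lacunary {α : ℝ} (hα : 0 < α) {A : ℝ} (hA : 0 ≤ A) :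
    MemHZCircle α (lacunary fun n => A * ((2 : ℝ) ^ (-α)) ^ n) := by
  have hc0 : ∀ n : ℕ, 0 ≤ A * ((2 : ℝ) ^ (-α)) ^ n := fun n => by positivity
  have hunif := tendstoUniformlyOn_lacunaryPartial (summable_const_mul_two_rpow_pow hα A) hc0
  set m := Nat.floor α + 1 with hm
  have hmα : α < m := by
    rw [hm]
    exact_mod_cast Nat.lt_floor_add_one α
  have hq1 : (2 : ℝ) ^ (-α) < 1 := Real.rpow_lt_one_of_one_lt_of_neg one_lt_two (by linarith)
  have hρ1 : 1 < (2 : ℝ) ^ m * 2 ^ (-α) := by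
    rw [← Real.rpow_natCast, ← Real.rpow_add two_pos]
    exact Real.one_lt_rpow one_lt_two (by linarith)
  set K : ℝ := 2 ^ m * (2 ^ m * 2 ^ (-α) / (2 ^ m * 2 ^ (-α) - 1) + 1 / (1 - 2 ^ (-α))) with hK
  have hK0 : 0 ≤ K := by
    have : 0 < (2 : ℝ) ^ m * 2 ^ (-α) - 1 := by linarith
    have : 0 < 1 - (2 : ℝ) ^ (-α) := by linarith
    positivity
  refine ⟨hunif.continuousOn (Frequently.of_forall fun N =>
    (continuous_lacunaryPartial _ N).continuousOn), 2 * A * K, by positivity, ?_⟩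
  intro ζ τ hζ hτ
  refine le_of_tendsto (tendsto_cdiff_iterate hτ
    (fun z hz => hunif.tendsto_at (by simpa using hz)) m ζ hζ).norm
    (Eventually.of_forall fun N => ?_)
  refine (norm_cdiff_iterate_lacunaryPartial_le hc0 N hτ m hζ).trans ?_
  rcases eq_or_lt_of_le (norm_nonneg (1 - τ)) with h0 | hpos
  · rw [← h0]
    simp [hm, hα.ne']
  · have hle2 : ‖1 - τ‖ ≤ 2 := by
      simpa [norm_sub_rev] using norm_pow_sub_one_le_two hτ 1
    have := mul_le_mul_of_nonneg_left (sum_geometric_mul_min_pow_le hα hmα hpos hle2 N)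
      (mul_nonneg two_pos.le hA)
    rw [Finset.mul_sum] at this ⊢
    calc _ = ∑ n ∈ Finset.range N,
          2 * A * (((2 : ℝ) ^ (-α)) ^ n * min 2 (2 ^ n * ‖1 - τ‖) ^ m) :=
          Finset.sum_congr rfl fun n _ => by ring
      _ ≤ _ := this
      _ = _ := by rw [hK]; ring

section HilbertBasis

variable {H : Type} [NormedAddCommGroup H] [InnerProductSpace ℂ H]

theorem HilbertBasis.clm_ext {ι : Type} (b : HilbertBasis ι ℂ H) {S T : H →L[ℂ] H}
    (h : ∀ i, S (b i) = T (b i)) : S = T :=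
  ContinuousLinearMap.ext_on (Submodule.dense_iff_topologicalClosure_eq_top.2 b.dense_span)
    (by rintro _ ⟨i, rfl⟩; exact h i)

theorem HilbertBasis.separableSpace {ι : Type} [Countable ι] (b : HilbertBasis ι ℂ H) :
    TopologicalSpace.SeparableSpace H := by
  have h := (Set.countable_range b).isSeparable.span (R := ℂ) |>.closure
  rw [← Submodule.topologicalClosure_coe, b.dense_span] at h
  exact TopologicalSpace.isSeparable_univ_iff.1 h

theorem shift_pow_apply {b : HilbertBasis ℤ ℂ H} {s : ℤ → ℝ} (hs : ∀ k, s k * s k = 1)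
    {U : H →L[ℂ] H} (hU : ∀ k, U (b k) = ((s k : ℂ) * s (k + 1)) • b (k + 1)) (p : ℕ) (k : ℤ) :
    (U ^ p) (b k) = ((s k : ℂ) * s (k + p)) • b (k + p) := by
  have hs' : ∀ k, (s k : ℂ) * s k = 1 := fun k => by exact_mod_cast hs k
  induction p with
  | zero => simp [hs']
  | succ p ih =>
    rw [pow_succ', mul_apply_eq_comp, ih, map_smul, hU, smul_smul]
    push_cast
    rw [← add_assoc]
    congr 1
    linear_combination (s k : ℂ) * s (k + p + 1) * hs' (k + p)

theorem inner_shift_pow {b : HilbertBasis ℤ ℂ H} {s : ℤ → ℝ} (hs : ∀ k, s k * s k = 1)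
    {U : H →L[ℂ] H} (hU : ∀ k, U (b k) = ((s k : ℂ) * s (k + 1)) • b (k + 1)) (p : ℕ) (i k : ℤ) :
    inner ℂ (b i) ((U ^ p) (b k)) = if i = k + p then (s i : ℂ) * s k else 0 := by
  rw [shift_pow_apply hs hU, inner_smul_right, orthonormal_iff_ite.1 b.orthonormal]
  split_ifs with h
  · rw [h, mul_one, mul_comm]
  · rw [mul_zero]

variable [CompleteSpace H]

theorem HilbertBasis.exists_smul_reindex {ι κ : Type} (b : HilbertBasis ι ℂ H) (e : κ ≃ ι)
    (s : κ → ℂ) (hs : ∀ k, ‖s k‖ = 1) :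
    ∃ b' : HilbertBasis κ ℂ H, ∀ k, b' k = s k • b (e k) := by
  classical
  have ho : Orthonormal ℂ fun k => s k • b (e k) := by
    refine ⟨fun k => by simp [norm_smul, hs, b.orthonormal.1], fun i j hij => ?_⟩
    simp [inner_smul_left, inner_smul_right, b.orthonormal.2 (e.injective.ne hij)]
  refine ⟨HilbertBasis.mkOfOrthogonalEqBot ho ?_, fun k => by
    rw [HilbertBasis.coe_mkOfOrthogonalEqBot]⟩
  rw [Submodule.eq_bot_iff]
  intro x hx
  rw [Submodule.mem_orthogonal] at hx
  apply b.repr.injective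
  ext i
  rw [b.repr_apply_apply]
  have h := hx _ (Submodule.subset_span ⟨e.symm i, rfl⟩)
  have hne : s (e.symm i) ≠ 0 := by
    rw [← norm_ne_zero_iff, hs]
    exact one_ne_zero
  simpa [inner_smul_left, hne] using h

/-- A weighted bilateral shift with unimodular weights is unitary. -/
theorem HilbertBasis.exists_unitary_shift (b : HilbertBasis ℤ ℂ H) (s : ℤ → ℂ)
    (hs : ∀ k, ‖s k‖ = 1) :
    ∃ U ∈ unitary (H →L[ℂ] H), ∀ k, U (b k) = (s k * s (k + 1)) • b (k + 1) := by
  classical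
  obtain ⟨b', hb'⟩ := b.exists_smul_reindex (Equiv.addRight 1) (fun k => s k * s (k + 1))
    (fun k => by simp [hs])
  refine ⟨(Unitary.linearIsometryEquiv.symm (b.repr.trans b'.repr.symm) : H →L[ℂ] H),
    SetLike.coe_mem _, fun k => ?_⟩
  simp [b.repr_self, b'.repr_symm_single, hb']

theorem cfc_lacunaryPartial (c : ℕ → ℝ) (N : ℕ) {U : H →L[ℂ] H}
    (hU : U ∈ unitary (H →L[ℂ] H)) :
    cfc (lacunaryPartial c N) U =
      ∑ n ∈ Finset.range N, (c n : ℂ) • (U ^ 2 ^ n + star (U ^ 2 ^ n)) := by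
  have hn : IsStarNormal U := isStarNormal_of_mem_unitary hU
  have h : lacunaryPartial c N =
      ∑ n ∈ Finset.range N, fun ζ => (c n : ℂ) * (ζ ^ 2 ^ n + star (ζ ^ 2 ^ n)) := by
    ext ζ
    simp [lacunaryPartial]
  rw [h, cfc_sum _ _ _ fun n _ => by fun_prop]
  refine Finset.sum_congr rfl fun n _ => ?_
  rw [cfc_const_mul _ _ _ (by fun_prop), cfc_add (a := U) (fun ζ => ζ ^ 2 ^ n)
    (fun ζ => star (ζ ^ 2 ^ n)) (by fun_prop) (by fun_prop), cfc_star, cfc_pow_id U]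

/-- Below the diagonal, the matrix of `lacunary c` evaluated at a weighted shift is read off the
coefficients. -/
theorem inner_cfc_lacunary {c : ℕ → ℝ} (hc : Summable c) (hc0 : ∀ n, 0 ≤ c n)
    {b : HilbertBasis ℤ ℂ H} {s : ℤ → ℝ} (hs : ∀ k, s k * s k = 1) {U : H →L[ℂ] H}
    (hU : U ∈ unitary (H →L[ℂ] H))
    (hUb : ∀ k, U (b k) = ((s k : ℂ) * s (k + 1)) • b (k + 1)) {i k : ℤ} (hik : k < i) {a : ℂ}
    (ha : ∀ᶠ N in atTop, ∑ n ∈ Finset.range N, (if i = k + 2 ^ n then (c n : ℂ) else 0) = a) :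
    inner ℂ (b i) (cfc (lacunary c) U (b k)) = a * (s i * s k) := by
  have hlim : Tendsto (fun N => cfc (lacunaryPartial c N) U) atTop (𝓝 (cfc (lacunary c) U)) :=
    tendsto_cfc_fun ((tendstoUniformlyOn_lacunaryPartial hc hc0).mono
      (spectrum.subset_circle_of_unitary hU))
      (Eventually.of_forall fun N => (continuous_lacunaryPartial c N).continuousOn)
  have hlim' : Tendsto (fun N => inner ℂ (b i) (cfc (lacunaryPartial c N) U (b k))) atTop
      (𝓝 (inner ℂ (b i) (cfc (lacunary c) U (b k)))) := by
    have hcont : Continuous fun T : H →L[ℂ] H => inner ℂ (b i) (T (b k)) := by fun_prop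
    exact (hcont.tendsto _).comp hlim
  refine tendsto_nhds_unique hlim' (tendsto_const_nhds.congr' ?_)
  filter_upwards [ha] with N hN
  rw [cfc_lacunaryPartial c N hU, sum_apply, inner_sum, ← hN, Finset.sum_mul]
  refine Finset.sum_congr rfl fun n _ => ?_
  have hadj : inner ℂ (b i) (star (U ^ 2 ^ n) (b k)) = 0 := by
    rw [ContinuousLinearMap.star_eq_adjoint, ContinuousLinearMap.adjoint_inner_right,
      ← inner_conj_symm, inner_shift_pow hs hUb, if_neg, map_zero]
    push_cast
    have : (0 : ℤ) < 2 ^ n := by positivity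
    omega
  rw [smul_apply, add_apply, inner_smul_right,
    inner_add_right, hadj, inner_shift_pow hs hUb]
  push_cast
  split_ifs <;> simp

/-- If `T` acts as `a` times a partial isometry between two `n`-dimensional coordinate blocks,
then its singular values of index below `n` are at least `‖a‖`. -/
theorem norm_le_sVal_of_inner_eq {n j : ℕ} (hj : j < n) {u v : Fin n → H} (hu : Orthonormal ℂ u)
    (hv : Orthonormal ℂ v) {T : H →L[ℂ] H} {a : ℂ}
    (hT : ∀ i k, inner ℂ (v i) (T (u k)) = if i = k then a else 0) : ‖a‖ ≤ sVal T j := by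
  refine le_csInf ⟨_, 0, by simp, rfl⟩ ?_
  rintro _ ⟨R, hR, rfl⟩
  obtain ⟨x, hx0, hx⟩ : ∃ x : Fin n → ℂ, x ≠ 0 ∧ R (∑ k, x k • u k) = 0 := by
    let L : (Fin n → ℂ) →ₗ[ℂ] H := (R : H →ₗ[ℂ] H) ∘ₗ Fintype.linearCombination ℂ u
    by_contra! hcon
    have hinj : Function.Injective L := by
      rw [← LinearMap.ker_eq_bot, LinearMap.ker_eq_bot']
      intro x hx
      by_contra hne
      exact hcon x hne hx
    have h1 : LinearMap.rank L = n := by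
      rw [LinearMap.rank, ← (LinearEquiv.ofInjective L hinj).rank_eq]
      simp
    have h2 : LinearMap.rank L ≤ LinearMap.rank (R : H →ₗ[ℂ] H) := LinearMap.rank_comp_le_left _ _
    rw [h1] at h2
    exact absurd (Nat.cast_le.1 (h2.trans hR)) (not_le.2 hj)
  set w := ∑ k, x k • u k with hw
  have hnw : ‖w‖ ^ 2 = ∑ k, ‖x k‖ ^ 2 := by
    have h := hu.inner_sum x x Finset.univ
    rw [← hw, inner_self_eq_norm_sq_to_K] at h
    have h' : ((‖w‖ ^ 2 : ℝ) : ℂ) = ((∑ k, ‖x k‖ ^ 2 : ℝ) : ℂ) := by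
      push_cast
      rw [← Complex.coe_algebraMap, h]
      simp [← Complex.conj_mul']
    exact_mod_cast h'
  have hw0 : 0 < ‖w‖ := by
    obtain ⟨k, hk⟩ := Function.ne_iff.1 hx0
    have : 0 < ∑ k, ‖x k‖ ^ 2 := Finset.sum_pos' (fun _ _ => by positivity)
      ⟨k, Finset.mem_univ k, by have := norm_pos_iff.2 hk; positivity⟩
    rw [← hnw] at this
    exact norm_pos_iff.2 fun h => by simp [h] at this
  have hTw : (‖a‖ * ‖w‖) ^ 2 ≤ ‖T w‖ ^ 2 := by
    refine le_trans (le_of_eq ?_) (hv.sum_inner_products_le (T w) (s := Finset.univ))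
    have h : ∀ i, inner ℂ (v i) (T w) = x i * a := fun i => by
      simp [hw, hT]
    simp only [h, norm_mul, mul_pow]
    rw [hnw, Finset.mul_sum]
    exact Finset.sum_congr rfl fun i _ => mul_comm _ _
  have h3 : ‖a‖ * ‖w‖ ≤ ‖T w‖ := le_of_sq_le_sq hTw (norm_nonneg _)
  have h4 : ‖T w‖ ≤ ‖T - R‖ * ‖w‖ := by
    simpa [hx] using (T - R).le_opNorm w
  exact le_of_mul_le_mul_right (h3.trans h4) hw0

end HilbertBasis

theorem stmt13 (α : ℝ) (hα : 0 < α) :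
    TopologicalSpace.SeparableSpace ellTwo ∧
    ∃ U V : ellTwo →L[ℂ] ellTwo, U ∈ unitary (ellTwo →L[ℂ] ellTwo) ∧
      V ∈ unitary (ellTwo →L[ℂ] ellTwo) ∧
      LinearMap.rank ((U - V : ellTwo →L[ℂ] ellTwo) : ellTwo →ₗ[ℂ] ellTwo) = 1 ∧
      ∃ h : ℂ → ℂ, (∀ ζ : ℂ, ‖ζ‖ = 1 → (h ζ).im = 0) ∧ MemHZCircle α h ∧
        ∀ m : ℕ, (1 + (m : ℝ)) ^ (-α) ≤ sVal (cfc h U - cfc h V) m := by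
  obtain ⟨b, -⟩ := (HilbertBasis.ofRepr (LinearIsometryEquiv.refl ℂ ellTwo)).exists_smul_reindex
    (Denumerable.eqv ℤ) 1 (by simp)
  refine ⟨b.separableSpace, ?_⟩
  set σ : ℤ → ℝ := fun k => if k < 0 then -1 else 1 with hσdef
  have hσ : ∀ k, σ k * σ k = 1 := fun k => by simp only [hσdef]; split_ifs <;> norm_num
  obtain ⟨U, hU, hUb⟩ := b.exists_unitary_shift 1 (by simp)
  obtain ⟨V, hV, hVb⟩ := b.exists_unitary_shift (fun k => (σ k : ℂ))
    (fun k => by simp only [hσdef]; split_ifs <;> simp)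
  have hrank : U - V = InnerProductSpace.rankOne ℂ ((2 : ℂ) • b 0) (b (-1)) := by
    refine b.clm_ext fun k => ?_
    rw [sub_apply, hUb, hVb, InnerProductSpace.rankOne_apply,
      orthonormal_iff_ite.1 b.orthonormal]
    rcases lt_trichotomy k (-1) with hk | rfl | hk
    · simp [hσdef, show k < 0 by omega, show k + 1 < 0 by omega, show -1 ≠ k by omega]
    · simp [hσdef, two_smul]
    · simp [hσdef, show ¬ k < 0 by omega, show ¬ k + 1 < 0 by omega, show -1 ≠ k by omega]
  have hbne : ∀ k, b k ≠ 0 := fun k => b.orthonormal.ne_zero k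
  refine ⟨U, V, hU, hV, ?_, ?_⟩
  · rw [hrank]
    exact InnerProductSpace.rank_rankOne (smul_ne_zero two_ne_zero (hbne 0)) (hbne (-1))
  set c : ℕ → ℝ := fun n => 4 ^ α * ((2 : ℝ) ^ (-α)) ^ n with hcdef
  have hc : Summable c := summable_const_mul_two_rpow_pow hα _
  have hc0 : ∀ n, 0 ≤ c n := fun n => by positivity
  refine ⟨lacunary c, fun ζ _ => lacunary_im ζ, memHZCircle_lacunary hα (by positivity), ?_⟩
  intro m
  set n := Nat.log 2 (m + 1) + 1 with hn
  have hmn : m < 2 ^ n := (Nat.lt_succ_self m).trans (Nat.lt_pow_succ_log_self one_lt_two _)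
  have hnm : 2 ^ (n + 1) ≤ 4 * (m + 1) := by
    have := Nat.pow_log_le_self 2 (Nat.succ_ne_zero m)
    rw [hn, pow_succ, pow_succ]
    simp only [Nat.succ_eq_add_one] at this
    omega
  have hcn : (1 + (m : ℝ)) ^ (-α) ≤ c (n + 1) := by
    have h1 : ((2 : ℝ) ^ (-α)) ^ (n + 1) = ((2 : ℝ) ^ (n + 1)) ^ (-α) := by
      rw [← Real.rpow_natCast, ← Real.rpow_natCast, ← Real.rpow_mul two_pos.le,
        ← Real.rpow_mul two_pos.le, mul_comm]
    have h2 : (4 * (1 + (m : ℝ))) ^ (-α) ≤ ((2 : ℝ) ^ (n + 1)) ^ (-α) := by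
      refine Real.rpow_le_rpow_of_nonpos (by positivity) ?_ (by linarith)
      rw [add_comm 1 (m : ℝ)]
      exact_mod_cast hnm
    have h3 : (1 + (m : ℝ)) ^ (-α) = 4 ^ α * (4 * (1 + (m : ℝ))) ^ (-α) := by
      rw [Real.mul_rpow (by norm_num) (by positivity), ← mul_assoc, ← Real.rpow_add (by norm_num)]
      simp
    simp only [hcdef]
    rw [h1, h3]
    gcongr
  have hnorm : ‖(2 * c (n + 1) : ℂ)‖ = 2 * c (n + 1) := by
    rw [norm_mul, Complex.norm_real, Real.norm_of_nonneg (hc0 _)]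
    simp
  refine le_trans (by rw [hnorm]; linarith [hc0 (n + 1)]) (norm_le_sVal_of_inner_eq hmn
    (u := fun k => b ((k : ℤ) - 2 ^ (n + 1))) (v := fun i => b (i : ℤ))
    (b.orthonormal.comp _ fun i j h => by simpa [Fin.ext_iff] using h)
    (b.orthonormal.comp _ fun i j h => by simpa [Fin.ext_iff] using h) (a := 2 * c (n + 1)) ?_)
  intro i k
  have hi : (i : ℤ) < 2 ^ n := by exact_mod_cast i.2
  have hk : (k : ℤ) < 2 ^ n := by exact_mod_cast k.2
  have hpow : (2 : ℤ) ^ (n + 1) = 2 * 2 ^ n := by ring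
  have hiff : ∀ q : ℕ, (i : ℤ) = (k : ℤ) - 2 ^ (n + 1) + 2 ^ q ↔ q = n + 1 ∧ i = k := by
    intro q
    rw [Fin.ext_iff]
    constructor
    · intro h
      have hq1 : (2 : ℤ) ^ n < 2 ^ q := by omega
      have hq2 : (2 : ℤ) ^ q < 2 ^ (n + 2) := by rw [pow_add]; omega
      have hq1' := (pow_lt_pow_iff_right₀ one_lt_two).1 hq1
      have hq2' := (pow_lt_pow_iff_right₀ one_lt_two).1 hq2
      obtain rfl : q = n + 1 := by omega
      exact ⟨rfl, by omega⟩
    · rintro ⟨rfl, h⟩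
      omega
  have ha : ∀ᶠ N in atTop, ∑ q ∈ Finset.range N,
      (if (i : ℤ) = (k : ℤ) - 2 ^ (n + 1) + 2 ^ q then (c q : ℂ) else 0) =
        if i = k then (c (n + 1) : ℂ) else 0 := by
    filter_upwards [eventually_gt_atTop (n + 1)] with N hN
    simp only [hiff, ite_and, Finset.sum_ite_eq', Finset.mem_range, hN, if_true]
  have hlt : (k : ℤ) - 2 ^ (n + 1) < i := by omega
  rw [sub_apply, inner_sub_right,
    inner_cfc_lacunary hc hc0 (s := 1) (by simp) hU (by simpa using hUb) hlt ha,
    inner_cfc_lacunary hc hc0 hσ hV hVb hlt ha]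
  simp only [hσdef, show ¬ (i : ℤ) < 0 by omega, show (k : ℤ) - 2 ^ (n + 1) < 0 by omega, if_true,
    if_false]
  split_ifs
  · simp
    ring
  · simp
end
end
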